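/- Let q ≥ 2, ζ = exp(2πi/q), and let D, S ∈ M_q(ℂ) be the clock and shift matrices. Then there do not exist commuting unitaries x, y ∈ M_q(ℂ) such that D x D* = x, S x S* = ζ^{−1} x, D y D* = ζ y, and S y S* = y. (Consequently the free (ℤ/q)²-action on M_q(ℂ) generated by conjugation by D and by S admits no equivariant unital *-homomorphism from C((ℤ/q)²), and its weak local-triviality dimension is infinite; thus freeness of an action does not imply finiteness of the weak local-triviality dimension.) -/

import Mathlib

/-- `ζ = exp(2πi/q)`. -/
noncomputable def ltZeta (q : ℕ) : ℂ := Complex.exp (2 * Real.pi * Complex.I / q)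

/-- The clock matrix `D = diag(1, ζ, ζ², …, ζ^{q-1})`. -/
noncomputable def clockMat (q : ℕ) : Matrix (Fin q) (Fin q) ℂ :=
  Matrix.diagonal fun i : Fin q => ltZeta q ^ (i : ℕ)

/-- The cyclic shift matrix `S`, with `S e_i = e_{i+1 (mod q)}`. -/
def shiftMat (q : ℕ) : Matrix (Fin q) (Fin q) ℂ :=
  Matrix.of fun j i : Fin q => if (j : ℕ) = ((i : ℕ) + 1) % q then 1 else 0

/-- For `q ≥ 2` there are no commuting unitaries
`x, y ∈ M_q(ℂ)` with `D x D* = x`, `S x S* = ζ⁻¹ x`, `D y D* = ζ y`, `S y S* = y`.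
Consequently the free `(ℤ/q)²`-action on `M_q(ℂ)` generated by conjugation by the
clock and shift matrices admits no equivariant unital *-homomorphism from
`C((ℤ/q)²)`, and its weak local-triviality dimension is infinite. -/
theorem stmt14 (q : ℕ) (hq : 2 ≤ q) :
    ¬ ∃ x y : Matrix (Fin q) (Fin q) ℂ,
      x ∈ unitary (Matrix (Fin q) (Fin q) ℂ) ∧
      y ∈ unitary (Matrix (Fin q) (Fin q) ℂ) ∧
      x * y = y * x ∧
      clockMat q * x * star (clockMat q) = x ∧
      shiftMat q * x * star (shiftMat q) = (ltZeta q)⁻¹ • x ∧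
      clockMat q * y * star (clockMat q) = ltZeta q • y ∧
      shiftMat q * y * star (shiftMat q) = y := by
  rintro ⟨x, y, hx, hy, hxy, hDx, hSx, hDy, -⟩
  have hz : IsPrimitiveRoot (ltZeta q) q := Complex.isPrimitiveRoot_exp q (by omega)
  let o : Fin q := ⟨0, by omega⟩
  let l : Fin q := ⟨1, by omega⟩
  have hlo : l ≠ o := by simp [l, o]
  -- column 0 of x is supported at row 0
  have x0 : ∀ i, i ≠ o → x i o = 0 := by
    intro i hi
    have h := congrFun (congrFun hDx i) o
    simp only [clockMat, Matrix.star_eq_conjTranspose, Matrix.diagonal_conjTranspose,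
      Matrix.mul_diagonal, Matrix.diagonal_mul, Pi.star_apply, o, pow_zero, star_one,
      mul_one] at h
    by_contra hne
    have h1 : ltZeta q ^ (i : ℕ) = ltZeta q ^ 0 := by
      rw [pow_zero]
      exact mul_right_cancel₀ hne (by rw [one_mul]; exact h)
    exact hi (Fin.ext (hz.pow_inj i.2 (by omega) h1))
  -- column 0 of y is supported at row 1
  have y0 : ∀ i, i ≠ l → y i o = 0 := by
    intro i hi
    have h := congrFun (congrFun hDy i) o
    simp only [clockMat, Matrix.star_eq_conjTranspose, Matrix.diagonal_conjTranspose,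
      Matrix.mul_diagonal, Matrix.diagonal_mul, Pi.star_apply, o, pow_zero, star_one,
      mul_one, Matrix.smul_apply, smul_eq_mul] at h
    by_contra hne
    have h1 : ltZeta q ^ (i : ℕ) = ltZeta q ^ 1 := by
      rw [pow_one]
      exact mul_right_cancel₀ hne h
    exact hi (Fin.ext (hz.pow_inj i.2 (by omega) h1))
  have xne : x o o ≠ 0 := by
    intro h0
    have h := congrFun (congrFun (Unitary.mem_iff.1 hx).1 o) o
    rw [Matrix.mul_apply, Finset.sum_eq_zero] at h
    · simp at h
    · intro k _
      by_cases hk : k = o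
      · rw [hk, h0, mul_zero]
      · rw [x0 k hk, mul_zero]
  have yne : y l o ≠ 0 := by
    intro h0
    have h := congrFun (congrFun (Unitary.mem_iff.1 hy).1 o) o
    rw [Matrix.mul_apply, Finset.sum_eq_zero] at h
    · simp at h
    · intro k _
      by_cases hk : k = l
      · rw [hk, h0, mul_zero]
      · rw [y0 k hk, mul_zero]
  have hc : x l l * y l o = y l o * x o o := by
    have h := congrFun (congrFun hxy l) o
    rw [Matrix.mul_apply, Matrix.mul_apply, Finset.sum_eq_single l, Finset.sum_eq_single o] at h
    · exact h
    · intro b _ hb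
      rw [x0 b hb, mul_zero]
    · simp
    · intro b _ hb
      rw [y0 b hb, mul_zero]
    · simp
  have hxx : x l l = x o o := mul_right_cancel₀ yne (by rw [hc, mul_comm])
  have hS0 : shiftMat q l o = 1 := by
    simp [shiftMat, l, o, Nat.mod_eq_of_lt (show 1 < q by omega)]
  have hS : ∀ k, k ≠ o → shiftMat q l k = 0 := by
    intro k hk
    have hk0 : (k : ℕ) ≠ 0 := fun h => hk (Fin.ext h)
    have : 1 ≠ ((k : ℕ) + 1) % q := by
      rcases Nat.lt_or_ge ((k : ℕ) + 1) q with h | h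
      · rw [Nat.mod_eq_of_lt h]; omega
      · have : (k : ℕ) + 1 = q := by omega
        rw [this, Nat.mod_self]; omega
    simp [shiftMat, l, this]
  have hs : x o o = (ltZeta q)⁻¹ * x l l := by
    have h := congrFun (congrFun hSx l) l
    rw [Matrix.mul_apply, Finset.sum_eq_single o, Matrix.mul_apply, Finset.sum_eq_single o] at h
    · simpa [Matrix.star_apply, hS0] using h
    · intro b _ hb
      rw [hS b hb, zero_mul]
    · simp
    · intro b _ hb
      rw [Matrix.star_apply, hS b hb, star_zero, mul_zero]
    · simp
  rw [hxx] at hs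
  have h1 : (ltZeta q)⁻¹ = 1 := mul_right_cancel₀ xne (by rw [one_mul]; exact hs.symm)
  exact hz.ne_one (by omega) (inv_eq_one.1 h1)
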